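/- arXiv:2411.05432 — 4 statements merged into one kernel-verified Lean document; each statement's English description precedes it below -/
import Mathlib

section
/- There exists a universal constant K > 0 such that the following holds. Let (X, dist) be a finite metric space with at least two points, with doubling dimension at most ddim ≥ 1, minimum interpoint distance γ, aspect ratio Δ := diam(X)/γ, and let ℓ := ⌈log₂ Δ⌉. Then there exists a probability distribution over sequences of partitions (P_0, P_1, …, P_{ℓ+1}) of X such that: (i) P_{ℓ+1} = {X} and every part of P_0 is a singleton; (ii) for each 1 ≤ i ≤ ℓ+1, the partition P_{i−1} refines P_i, and every part of P_i is the union of at most 2^{5·ddim} parts of P_{i−1}; (iii) every part of P_i has diameter at most 2^i·γ; and (iv) for every pair x, y ∈ X and every level 0 ≤ i ≤ ℓ+1, the probability that x and y lie in different parts of P_i is at most K·ddim·dist(x, y)/(2^i·γ). -/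
open Metric

def DoublingDimLE {M : Type*} [MetricSpace M] (X : Set M) (D : ℕ) : Prop :=
  ∀ x ∈ X, ∀ r : ℝ, 0 < r → ∃ T : Finset M, ↑T ⊆ X ∧ T.card ≤ 2 ^ D ∧
    X ∩ Metric.closedBall x r ⊆ ⋃ y ∈ T, Metric.closedBall y (r / 2)

/-- `Λ` is a partition of the finite set `X`: its parts are nonempty subsets of `X`
and every point of `X` belongs to exactly one part. -/
def IsPartitionOf {M : Type*} (X : Finset M) (Λ : Finset (Finset M)) : Prop :=
  (∀ C ∈ Λ, C ⊆ X) ∧ (∀ C ∈ Λ, C.Nonempty) ∧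
  (∀ x ∈ X, ∃! C, C ∈ Λ ∧ x ∈ C)

/-- Minimum interpoint distance of a metric space. -/
noncomputable def minSep (M : Type*) [MetricSpace M] : ℝ :=
  ⨅ p : {p : M × M // p.1 ≠ p.2}, dist p.1.1 p.1.2

/-- In a doubling space, a ball of radius `r` is covered by `2 ^ (k * D)` balls of radius
`r / 2 ^ k`. -/
theorem DoublingDimLE.exists_cover {M : Type*} [MetricSpace M] {D : ℕ}
    (h : DoublingDimLE (Set.univ : Set M) D) (x : M) {r : ℝ} (hr : 0 < r) (k : ℕ) :
    ∃ T : Finset M, T.card ≤ 2 ^ (k * D) ∧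
      ∀ y, dist y x ≤ r → ∃ t ∈ T, dist y t ≤ r / 2 ^ k := by
  classical
  induction k with
  | zero => exact ⟨{x}, by simp, fun y hy => ⟨x, by simp, by simpa using hy⟩⟩
  | succ k ih =>
    obtain ⟨T, hT, hcov⟩ := ih
    choose F hF using fun y : M => h y (Set.mem_univ y) (r / 2 ^ k) (by positivity)
    refine ⟨T.biUnion F, ?_, fun y hy => ?_⟩
    · calc (T.biUnion F).card ≤ T.card * 2 ^ D :=
            Finset.card_biUnion_le_card_mul _ _ _ fun t _ => (hF t).2.1
        _ ≤ 2 ^ (k * D) * 2 ^ D := Nat.mul_le_mul_right _ hT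
        _ = 2 ^ ((k + 1) * D) := by ring
    · obtain ⟨t, ht, hyt⟩ := hcov y hy
      have hmem := (hF t).2.2 ⟨Set.mem_univ y, mem_closedBall.2 hyt⟩
      simp only [Set.mem_iUnion, mem_closedBall] at hmem
      obtain ⟨u, hu, hyu⟩ := hmem
      refine ⟨u, Finset.mem_biUnion.2 ⟨t, ht, hu⟩, hyu.trans_eq ?_⟩
      rw [pow_succ, div_div]

/-- A separated subset of a ball in a doubling space has bounded cardinality. -/
theorem DoublingDimLE.card_le_of_separated {M : Type*} [MetricSpace M] {D : ℕ}
    (h : DoublingDimLE (Set.univ : Set M) D) (x : M) {r : ℝ} (hr : 0 < r) (k : ℕ)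
    (S : Finset M) (hS : ∀ z ∈ S, dist z x ≤ r)
    (hsep : ∀ z ∈ S, ∀ w ∈ S, z ≠ w → 2 * (r / 2 ^ k) < dist z w) :
    S.card ≤ 2 ^ (k * D) := by
  obtain ⟨T, hT, hcov⟩ := h.exists_cover x hr k
  choose! g hg using fun z hz => hcov z (hS z hz)
  refine (Finset.card_le_card_of_injOn g (fun z hz => (hg z hz).1) ?_).trans hT
  intro z hz w hw hzw
  by_contra hne
  have h1 := (hg z hz).2
  have h2 := (hg w hw).2
  rw [← hzw] at h2
  have h3 := dist_triangle_right z w (g z)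
  linarith [hsep z hz w hw hne]

/-- Every finite metric space contains a separated set which is also a covering net. -/
theorem exists_finset_net (M : Type*) [MetricSpace M] [Fintype M] {ε : ℝ} (hε : 0 ≤ ε) :
    ∃ S : Finset M, (∀ z ∈ S, ∀ w ∈ S, z ≠ w → ε < dist z w) ∧
      ∀ x, ∃ z ∈ S, dist z x ≤ ε := by
  classical
  obtain ⟨S, hS, hmax⟩ := Finset.exists_max_image
    (Finset.univ.filter fun S : Finset M => ∀ z ∈ S, ∀ w ∈ S, z ≠ w → ε < dist z w)
    Finset.card ⟨∅, by simp⟩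
  simp only [Finset.mem_filter, Finset.mem_univ, true_and] at hS hmax
  refine ⟨S, hS, fun x => ?_⟩
  by_contra! hx
  have hxS : x ∉ S := fun hmem => by
    have := hx x hmem
    rw [dist_self] at this
    linarith
  have hins := hmax (insert x S) (by
    intro z hz w hw hne
    rw [Finset.mem_insert] at hz hw
    rcases hz with rfl | hz <;> rcases hw with rfl | hw
    · exact absurd rfl hne
    · rw [dist_comm]; exact hx w hw
    · exact hx z hz
    · exact hS z hz w hw hne)
  rw [Finset.card_insert_of_notMem hxS] at hins
  omega

/-- A fixed element of `S` is the first element of `S` in a uniformly random ordering with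
probability at most `1 / S.card`. -/
theorem card_mul_card_equiv_min_le {M : Type*} [Fintype M] [DecidableEq M] {n : ℕ}
    (S : Finset M) {z : M} (hz : z ∈ S) :
    S.card * (Finset.univ.filter fun e : M ≃ Fin n => ∀ w ∈ S, e z ≤ e w).card ≤
      Fintype.card (M ≃ Fin n) := by
  let B : M → Finset (M ≃ Fin n) := fun z => Finset.univ.filter fun e => ∀ w ∈ S, e z ≤ e w
  have hB : ∀ w ∈ S, (B z).card ≤ (B w).card := by
    intro w hw
    refine Finset.card_le_card_of_injOn (fun e => (Equiv.swap z w).trans e) ?_ ?_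
    · intro e he
      simp only [B, Finset.coe_filter, Finset.mem_univ, true_and, Set.mem_ofPred_eq,
        Equiv.trans_apply, Equiv.swap_apply_right] at he ⊢
      intro v hv
      refine he _ ?_
      rw [Equiv.swap_apply_def]
      split_ifs <;> assumption
    · intro e _ e' _ hee
      ext v
      have := congrArg (fun g : M ≃ Fin n => g (Equiv.swap z w v)) hee
      simpa using congrArg Fin.val this
  have hdisj : (S : Set M).PairwiseDisjoint B := by
    intro u hu v hv huv
    refine Finset.disjoint_left.2 fun e heu hev => huv ?_
    simp only [B, Finset.mem_filter, Finset.mem_univ, true_and] at heu hev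
    exact e.injective (le_antisymm (heu v hv) (hev u hu))
  calc S.card * (B z).card = ∑ _w ∈ S, (B z).card := by simp
    _ ≤ ∑ w ∈ S, (B w).card := Finset.sum_le_sum hB
    _ = (S.biUnion B).card := (Finset.card_biUnion hdisj).symm
    _ ≤ Fintype.card (M ≃ Fin n) := Finset.card_le_univ _

/-- The sum of the reciprocals of the ranks is at most a harmonic number. -/
theorem sum_inv_rank_le_harmonic {α : Type*} [DecidableEq α] (S : Finset α) (a : α → ℝ) :
    ∑ z ∈ S, (((S.filter fun w => a w ≤ a z).card : ℝ))⁻¹ ≤ (harmonic S.card : ℝ) := by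
  induction S using Finset.induction_on_max_value a with
  | empty => simp
  | insert z S hz hmax ih =>
    rw [Finset.sum_insert hz, Finset.card_insert_of_notMem hz, harmonic_succ, add_comm]
    push_cast
    refine add_le_add (le_trans (Finset.sum_le_sum fun w hw => ?_) ih) ?_
    · have hpos : 0 < (S.filter fun v => a v ≤ a w).card :=
        Finset.card_pos.2 ⟨w, by simp [hw]⟩
      gcongr
      exact Finset.subset_insert _ _
    · rw [Finset.filter_true_of_mem, Finset.card_insert_of_notMem hz]
      · push_cast; exact le_rfl
      · intro w hw
        rcases Finset.mem_insert.1 hw with rfl | hw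
        · exact le_rfl
        · exact hmax w hw

theorem harmonic_le_of_le_two_pow {n D : ℕ} (hD : 1 ≤ D) (hn : n ≤ 2 ^ (4 * D)) :
    (harmonic n : ℝ) ≤ 5 * D := by
  have hD' : (1 : ℝ) ≤ D := by exact_mod_cast hD
  rcases Nat.eq_zero_or_pos n with rfl | hpos
  · simp
  have hlog : Real.log n ≤ 4 * D := by
    calc Real.log n ≤ Real.log (2 ^ (4 * D)) :=
          Real.log_le_log (by exact_mod_cast hpos) (by exact_mod_cast hn)
      _ = (4 * D : ℝ) * Real.log 2 := by rw [Real.log_pow]; push_cast; rfl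
      _ ≤ (4 * D : ℝ) * 1 :=
          mul_le_mul_of_nonneg_left (by linarith [Real.log_two_lt_d9]) (by positivity)
      _ = 4 * D := mul_one _
  linarith [harmonic_le_one_add_log n]

theorem card_fin_filter_Ico_le (N : ℕ) {u v : ℝ} (huv : u ≤ v) :
    ((Finset.univ.filter fun k : Fin N => u ≤ (k : ℕ) ∧ ((k : ℕ) : ℝ) < v).card : ℝ) ≤
      v - u + 1 := by
  have hcard : (Finset.univ.filter fun k : Fin N => u ≤ (k : ℕ) ∧ ((k : ℕ) : ℝ) < v).card ≤
      (Finset.Ico ⌈u⌉ ⌈v⌉).card := by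
    refine Finset.card_le_card_of_injOn (fun k => ((k : ℕ) : ℤ)) ?_ ?_
    · intro k hk
      simp only [Finset.coe_filter, Finset.mem_univ, true_and, Set.mem_ofPred_eq] at hk
      simp only [Finset.coe_Ico, Set.mem_Ico, Int.ceil_le, Int.lt_ceil]
      exact_mod_cast hk
    · intro k _ k' _ hkk
      exact Fin.ext (Int.ofNat_inj.1 hkk)
  have hceil : ⌈u⌉ ≤ ⌈v⌉ := Int.ceil_mono huv
  have hz : ((Finset.Ico ⌈u⌉ ⌈v⌉).card : ℤ) = ⌈v⌉ - ⌈u⌉ := by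
    rw [Int.card_Ico, Int.toNat_of_nonneg (by omega)]
  have hr : ((Finset.Ico ⌈u⌉ ⌈v⌉).card : ℝ) = (⌈v⌉ : ℝ) - ⌈u⌉ := by exact_mod_cast hz
  have hcard' : ((Finset.univ.filter fun k : Fin N =>
      u ≤ (k : ℕ) ∧ ((k : ℕ) : ℝ) < v).card : ℝ) ≤ (Finset.Ico ⌈u⌉ ⌈v⌉).card := by
    exact_mod_cast hcard
  linarith [Int.ceil_lt_add_one v, Int.le_ceil u]

/-- Random clustering at a single scale `s`: the points are assigned to centers by a random
ordering of the points and a random radius, with `N` equally likely radii. -/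
theorem exists_random_clustering {M : Type*} [MetricSpace M] [Fintype M] [DecidableEq M]
    {D : ℕ} (hD : 1 ≤ D) (h : DoublingDimLE (Set.univ : Set M) D) (N : ℕ)
    {s : ℝ} (hs : 0 < s) :
    ∃ f : (M ≃ Fin (Fintype.card M)) × Fin N → M → M,
      (∀ ω x, dist (f ω x) x < s / 2) ∧
      (∀ ω x y, f ω x ≠ f ω y → s / 4 < dist (f ω x) (f ω y)) ∧
      ∀ x y, s ≤ N * dist x y →
        ((Finset.univ.filter fun ω => f ω x ≠ f ω y).card : ℝ) * s ≤
          25 * D * dist x y * Fintype.card ((M ≃ Fin (Fintype.card M)) × Fin N) := by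
  obtain ⟨net, hsep, hcov⟩ := exists_finset_net M (ε := s / 4) (by positivity)
  let R : Fin N → ℝ := fun k => s / 4 * (1 + (k : ℕ) / N)
  have hN : ∀ k : Fin N, (0 : ℝ) < N := fun k => by exact_mod_cast k.pos
  have hR1 : ∀ k, s / 4 ≤ R k := fun k => by
    have : (0 : ℝ) ≤ (k : ℕ) / N := by positivity
    simp only [R]
    nlinarith
  have hR2 : ∀ k, R k < s / 2 := fun k => by
    have : ((k : ℕ) : ℝ) / N < 1 := (div_lt_one (hN k)).2 (by exact_mod_cast k.2)
    simp only [R]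
    nlinarith
  have hex : ∀ (ω : (M ≃ Fin (Fintype.card M)) × Fin N) (x : M), ∃ z ∈ net,
      dist z x ≤ R ω.2 ∧ ∀ w ∈ net, dist w x ≤ R ω.2 → ω.1 z ≤ ω.1 w := by
    intro ω x
    obtain ⟨z₀, hz₀, hzx⟩ := hcov x
    obtain ⟨z, hz, hmin⟩ := Finset.exists_min_image
      (net.filter fun z => dist z x ≤ R ω.2) ω.1
      ⟨z₀, Finset.mem_filter.2 ⟨hz₀, hzx.trans (hR1 _)⟩⟩
    rw [Finset.mem_filter] at hz
    exact ⟨z, hz.1, hz.2, fun w hw hwx => hmin w (Finset.mem_filter.2 ⟨hw, hwx⟩)⟩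
  choose f hfnet hfR hfmin using hex
  refine ⟨f, fun ω x => (hfR ω x).trans_lt (hR2 _),
    fun ω x y hne => hsep _ (hfnet ω x) _ (hfnet ω y) hne, fun x y hxy => ?_⟩
  have hD' : (1 : ℝ) ≤ D := by exact_mod_cast hD
  rcases lt_or_ge s (dist x y) with hlarge | hsmall
  · have hle : ((Finset.univ.filter fun ω => f ω x ≠ f ω y).card : ℝ) ≤
        Fintype.card ((M ≃ Fin (Fintype.card M)) × Fin N) := by
      exact_mod_cast Finset.card_le_univ _
    calc _ ≤ (Fintype.card ((M ≃ Fin (Fintype.card M)) × Fin N) : ℝ) * (25 * D * dist x y) := by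
          apply mul_le_mul hle _ hs.le (by positivity)
          nlinarith
      _ = _ := mul_comm _ _
  let a : M → ℝ := fun z => min (dist z x) (dist z y)
  let b : M → ℝ := fun z => max (dist z x) (dist z y)
  have hab : ∀ z, a z ≤ b z := fun z => min_le_max
  have hba : ∀ z, b z - a z ≤ dist x y := fun z => by
    have h1 := dist_triangle z x y
    have h2 := dist_triangle_right z x y
    rw [dist_comm z y] at h1
    have h3 := dist_triangle z y x
    rw [dist_comm y x] at h3
    simp only [a, b]
    rw [dist_comm z y] at *
    rcases le_total (dist z x) (dist y z) with hh | hh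
    · rw [max_eq_right hh, min_eq_left hh]; linarith
    · rw [max_eq_left hh, min_eq_right hh]; linarith
  let S : Finset M := net.filter fun z => a z ≤ s / 2
  let rk : M → Finset M := fun z => S.filter fun w => a w ≤ a z
  let A : M → Finset (Fin N) := fun z => Finset.univ.filter fun k => a z ≤ R k ∧ R k < b z
  let B : M → Finset (M ≃ Fin (Fintype.card M)) := fun z =>
    Finset.univ.filter fun e => ∀ w ∈ rk z, e z ≤ e w
  have key : ∀ (ω : (M ≃ Fin (Fintype.card M)) × Fin N) (z : M), z ∈ net →
      a z ≤ R ω.2 → R ω.2 < b z → (∀ w ∈ net, a w ≤ R ω.2 → ω.1 z ≤ ω.1 w) →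
      ω ∈ S.biUnion fun z => B z ×ˢ A z := by
    intro ω z hz h1 h2 h3
    simp only [Finset.mem_biUnion, Finset.mem_product, S, A, B, rk, Finset.mem_filter,
      Finset.mem_univ, true_and]
    exact ⟨z, ⟨hz, h1.trans (hR2 _).le⟩, fun w hw => h3 w hw.1.1 (hw.2.trans h1), h1, h2⟩
  have hsub : (Finset.univ.filter fun ω => f ω x ≠ f ω y) ⊆
      S.biUnion fun z => B z ×ˢ A z := by
    intro ω hω
    have hne : f ω x ≠ f ω y := (Finset.mem_filter.1 hω).2
    rcases le_total (ω.1 (f ω x)) (ω.1 (f ω y)) with hle | hle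
    · refine key ω (f ω x) (hfnet _ _) ((min_le_left _ _).trans (hfR ω x)) ?_ ?_
      · refine lt_of_lt_of_le ?_ (le_max_right _ _)
        by_contra! hcon
        exact hne (ω.1.injective (le_antisymm hle (hfmin ω y _ (hfnet ω x) hcon)))
      · intro w hw hwR
        rcases min_le_iff.1 hwR with hw' | hw'
        · exact hfmin ω x w hw hw'
        · exact hle.trans (hfmin ω y w hw hw')
    · refine key ω (f ω y) (hfnet _ _) ((min_le_right _ _).trans (hfR ω y)) ?_ ?_
      · refine lt_of_lt_of_le ?_ (le_max_left _ _)
        by_contra! hcon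
        exact hne (ω.1.injective (le_antisymm (hfmin ω x _ (hfnet ω y) hcon) hle))
      · intro w hw hwR
        rcases min_le_iff.1 hwR with hw' | hw'
        · exact hle.trans (hfmin ω x w hw hw')
        · exact hfmin ω y w hw hw'
  have hScard : S.card ≤ 2 ^ (4 * D) := by
    refine h.card_le_of_separated x (r := 3 / 2 * s) (by positivity) 4 S ?_ ?_
    · intro z hz
      rcases min_le_iff.1 (Finset.mem_filter.1 hz).2 with hz' | hz'
      · linarith
      · have := dist_triangle z y x
        rw [dist_comm y x] at this
        linarith
    · intro z hz w hw hne
      have := hsep z (Finset.mem_filter.1 hz).1 w (Finset.mem_filter.1 hw).1 hne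
      linarith
  have hN0 : (0 : ℝ) < N := by
    by_contra! hcon
    nlinarith [dist_nonneg (x := x) (y := y)]
  have hA : ∀ z, ((A z).card : ℝ) * s ≤ 5 * dist x y * N := by
    intro z
    have hmono : N * (4 * a z / s - 1) ≤ N * (4 * b z / s - 1) := by
      have := hab z
      gcongr
    have hc := card_fin_filter_Ico_le N hmono
    have hAeq : A z = Finset.univ.filter fun k : Fin N =>
        N * (4 * a z / s - 1) ≤ (k : ℕ) ∧ ((k : ℕ) : ℝ) < N * (4 * b z / s - 1) := by
      ext k
      simp only [A, R, Finset.mem_filter, Finset.mem_univ, true_and]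
      have e1 : ∀ t : ℝ, t ≤ s / 4 * (1 + (k : ℕ) / N) ↔ N * (4 * t / s - 1) ≤ (k : ℕ) := by
        intro t
        rw [← le_div_iff₀' hN0, sub_le_iff_le_add, div_le_iff₀ hs]
        constructor <;> intro <;> linarith
      rw [e1, ← not_le, e1, not_le]
    rw [hAeq]
    calc _ ≤ (N * (4 * b z / s - 1) - N * (4 * a z / s - 1) + 1) * s :=
          mul_le_mul_of_nonneg_right hc hs.le
      _ = 4 * (b z - a z) * N + s := by field_simp; ring
      _ ≤ 4 * dist x y * N + N * dist x y := by
          have := hba z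
          gcongr
      _ = 5 * dist x y * N := by ring
  have hB : ∀ z ∈ S, ((B z).card : ℝ) ≤
      ((rk z).card : ℝ)⁻¹ * Fintype.card (M ≃ Fin (Fintype.card M)) := by
    intro z hz
    have hmem : z ∈ rk z := Finset.mem_filter.2 ⟨hz, le_rfl⟩
    have hpos : (0 : ℝ) < (rk z).card := by exact_mod_cast Finset.card_pos.2 ⟨z, hmem⟩
    rw [inv_mul_eq_div, le_div_iff₀' hpos]
    exact_mod_cast card_mul_card_equiv_min_le (rk z) hmem
  have hharm : ∑ z ∈ S, ((rk z).card : ℝ)⁻¹ ≤ 5 * D :=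
    (sum_inv_rank_le_harmonic S a).trans (harmonic_le_of_le_two_pow hD hScard)
  have hcard : ((Finset.univ.filter fun ω => f ω x ≠ f ω y).card : ℝ) ≤
      ∑ z ∈ S, ((B z).card : ℝ) * (A z).card := by
    have := (Finset.card_le_card hsub).trans Finset.card_biUnion_le
    simp only [Finset.card_product] at this
    exact_mod_cast this
  calc ((Finset.univ.filter fun ω => f ω x ≠ f ω y).card : ℝ) * s
      ≤ (∑ z ∈ S, ((B z).card : ℝ) * (A z).card) * s := mul_le_mul_of_nonneg_right hcard hs.le
    _ = ∑ z ∈ S, ((B z).card : ℝ) * ((A z).card * s) := by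
        rw [Finset.sum_mul]; exact Finset.sum_congr rfl fun _ _ => mul_assoc _ _ _
    _ ≤ ∑ z ∈ S, ((rk z).card : ℝ)⁻¹ * Fintype.card (M ≃ Fin (Fintype.card M)) *
          (5 * dist x y * N) :=
        Finset.sum_le_sum fun z hz => mul_le_mul (hB z hz) (hA z) (by positivity) (by positivity)
    _ = (∑ z ∈ S, ((rk z).card : ℝ)⁻¹) * (Fintype.card (M ≃ Fin (Fintype.card M)) *
          (5 * dist x y * N)) := by
        rw [Finset.sum_mul]; exact Finset.sum_congr rfl fun _ _ => mul_assoc _ _ _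
    _ ≤ 5 * D * (Fintype.card (M ≃ Fin (Fintype.card M)) * (5 * dist x y * N)) :=
        mul_le_mul_of_nonneg_right hharm (by positivity)
    _ = 25 * D * dist x y * Fintype.card ((M ≃ Fin (Fintype.card M)) × Fin N) := by
        rw [Fintype.card_prod, Fintype.card_fin]; push_cast; ring

theorem minSep_le_dist {M : Type*} [MetricSpace M] [Finite M] {x y : M} (hxy : x ≠ y) :
    minSep M ≤ dist x y :=
  ciInf_le (f := fun p : {p : M × M // p.1 ≠ p.2} => dist p.1.1 p.1.2)
    (Set.finite_range _).bddBelow ⟨(x, y), hxy⟩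

theorem minSep_pos (M : Type*) [MetricSpace M] [Finite M] [Nontrivial M] : 0 < minSep M := by
  obtain ⟨x, y, hxy⟩ := exists_pair_ne M
  have : Nonempty {p : M × M // p.1 ≠ p.2} := ⟨⟨(x, y), hxy⟩⟩
  obtain ⟨p, hp⟩ := exists_eq_ciInf_of_finite
    (f := fun p : {p : M × M // p.1 ≠ p.2} => dist p.1.1 p.1.2)
  rw [minSep, ← hp]
  exact dist_pos.2 p.2

theorem dist_le_two_pow_mul_minSep {M : Type*} [MetricSpace M] [Finite M] [Nontrivial M]
    (x y : M) :
    dist x y ≤ 2 ^ ⌈Real.logb 2 (Metric.diam (Set.univ : Set M) / minSep M)⌉₊ * minSep M := by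
  have hγ := minSep_pos M
  have hdiam : ∀ u v : M, dist u v ≤ Metric.diam (Set.univ : Set M) := fun u v =>
    dist_le_diam_of_mem Set.finite_univ.isBounded (Set.mem_univ u) (Set.mem_univ v)
  obtain ⟨u, v, huv⟩ := exists_pair_ne M
  have hpos : 0 < Metric.diam (Set.univ : Set M) / minSep M :=
    div_pos ((dist_pos.2 huv).trans_le (hdiam u v)) hγ
  refine (hdiam x y).trans ((div_le_iff₀ hγ).1 ?_)
  have := (Real.logb_le_iff_le_rpow one_lt_two hpos).1
    (Nat.le_ceil (Real.logb 2 (Metric.diam (Set.univ : Set M) / minSep M)))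
  rwa [Real.rpow_natCast] at this

/-- The classes of the relation that identifies points with equal labels `g j` at all levels
`j` from `i` up to `L`. -/
noncomputable def labelClasses {M α : Type*} [Fintype M] [DecidableEq M] (g : ℕ → M → α)
    (L i : ℕ) : Finset (Finset M) :=
  open Classical in
  Finset.univ.image fun x => Finset.univ.filter fun y => ∀ j, i ≤ j → j ≤ L → g j x = g j y

section labelClasses

variable {M α : Type*} [Fintype M] [DecidableEq M] {g : ℕ → M → α} {L i : ℕ}

theorem mem_labelClasses {C : Finset M} :
    C ∈ labelClasses g L i ↔
      ∃ x, ∀ y, y ∈ C ↔ ∀ j, i ≤ j → j ≤ L → g j x = g j y := by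
  simp only [labelClasses, Finset.mem_image, Finset.mem_univ, true_and]
  refine exists_congr fun x => ⟨?_, fun h => ?_⟩
  · rintro rfl y; simp
  · ext y; simp [h y]

theorem label_eq_of_mem {C : Finset M} (hC : C ∈ labelClasses g L i) {x y : M} (hx : x ∈ C)
    (hy : y ∈ C) {j : ℕ} (hij : i ≤ j) (hj : j ≤ L) : g j x = g j y := by
  obtain ⟨z, hz⟩ := mem_labelClasses.1 hC
  exact ((hz x).1 hx j hij hj).symm.trans ((hz y).1 hy j hij hj)

theorem mem_of_label_eq {C : Finset M} (hC : C ∈ labelClasses g L i) {x y : M} (hx : x ∈ C)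
    (hxy : ∀ j, i ≤ j → j ≤ L → g j x = g j y) : y ∈ C := by
  obtain ⟨z, hz⟩ := mem_labelClasses.1 hC
  exact (hz y).2 fun j hij hj => ((hz x).1 hx j hij hj).trans (hxy j hij hj)

theorem exists_mem_labelClasses (g : ℕ → M → α) (L i : ℕ) (x : M) :
    ∃ C ∈ labelClasses g L i, ∀ y, y ∈ C ↔ ∀ j, i ≤ j → j ≤ L → g j x = g j y := by
  classical
  refine ⟨Finset.univ.filter fun y => ∀ j, i ≤ j → j ≤ L → g j x = g j y, ?_, by simp⟩
  exact mem_labelClasses.2 ⟨x, by simp⟩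

theorem nonempty_of_mem_labelClasses {C : Finset M} (hC : C ∈ labelClasses g L i) :
    C.Nonempty := by
  obtain ⟨x, hx⟩ := mem_labelClasses.1 hC
  exact ⟨x, (hx x).2 fun _ _ _ => rfl⟩

theorem isPartitionOf_labelClasses (g : ℕ → M → α) (L i : ℕ) :
    IsPartitionOf Finset.univ (labelClasses g L i) := by
  refine ⟨fun C _ => Finset.subset_univ C, fun C => nonempty_of_mem_labelClasses,
    fun x _ => ?_⟩
  obtain ⟨C, hC, hx⟩ := exists_mem_labelClasses g L i x
  have hxC : x ∈ C := (hx x).2 fun _ _ _ => rfl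
  refine ⟨C, ⟨hC, hxC⟩, ?_⟩
  rintro C' ⟨hC', hxC'⟩
  ext y
  exact ⟨fun hy => mem_of_label_eq hC hxC fun j => label_eq_of_mem hC' hxC' hy,
    fun hy => mem_of_label_eq hC' hxC' fun j => label_eq_of_mem hC hxC hy⟩

theorem labelClasses_succ_self [Nonempty M] (g : ℕ → M → α) (L : ℕ) :
    labelClasses g L (L + 1) = {Finset.univ} := by
  ext C
  rw [mem_labelClasses, Finset.mem_singleton, Finset.eq_univ_iff_forall]
  have hvac : ∀ x y j, L + 1 ≤ j → j ≤ L → g j x = g j y := fun x y j h1 h2 => by omega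
  exact ⟨fun ⟨x, hx⟩ y => (hx y).2 (hvac x y),
    fun h => ⟨Classical.arbitrary M, fun y => ⟨fun _ => hvac _ y, fun _ => h y⟩⟩⟩

theorem exists_superset_labelClasses {C' : Finset M} (hC' : C' ∈ labelClasses g L i) :
    ∃ C ∈ labelClasses g L (i + 1), C' ⊆ C := by
  obtain ⟨x, hx⟩ := mem_labelClasses.1 hC'
  obtain ⟨C, hC, hxC⟩ := exists_mem_labelClasses g L (i + 1) x
  exact ⟨C, hC, fun y hy => (hxC y).2 fun j hij => (hx y).1 hy j (by omega)⟩

/-- A class at level `i + 1` splits at level `i` according to the labels `g i`. -/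
theorem exists_children_labelClasses [DecidableEq α] {C : Finset M}
    (hC : C ∈ labelClasses g L (i + 1)) (hi : i ≤ L) :
    ∃ T ⊆ labelClasses g L i, T.card ≤ (C.image (g i)).card ∧
      ∀ x, x ∈ C ↔ ∃ C' ∈ T, x ∈ C' := by
  refine ⟨(C.image (g i)).image fun z => C.filter fun y => g i y = z, ?_,
    Finset.card_image_le, fun x => ?_⟩
  · intro C' hC'
    simp only [Finset.mem_image, exists_exists_and_eq_and] at hC'
    obtain ⟨x, hx, rfl⟩ := hC'
    refine mem_labelClasses.2 ⟨x, fun y => ?_⟩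
    rw [Finset.mem_filter]
    constructor
    · rintro ⟨hy, hxy⟩ j hij hj
      rcases hij.eq_or_lt with rfl | hlt
      · exact hxy.symm
      · exact label_eq_of_mem hC hx hy hlt hj
    · intro hxy
      exact ⟨mem_of_label_eq hC hx fun j hij => hxy j (by omega), (hxy i le_rfl hi).symm⟩
  · simp only [Finset.mem_image, exists_exists_and_eq_and, Finset.mem_filter]
    exact ⟨fun hx => ⟨x, hx, hx, rfl⟩, fun ⟨_, _, hx, _⟩ => hx⟩

end labelClasses

theorem sum_Icc_inv_two_pow_le (i L : ℕ) :
    ∑ j ∈ Finset.Icc i L, ((2 : ℝ) ^ j)⁻¹ ≤ 2 * (2 ^ i)⁻¹ := by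
  have hstrong : ∀ n, ∑ j ∈ Finset.Ico i (i + n), ((2 : ℝ) ^ j)⁻¹ =
      2 * (2 ^ i)⁻¹ - 2 * (2 ^ (i + n))⁻¹ := by
    intro n
    induction n with
    | zero => simp
    | succ n ih =>
      rw [← add_assoc, Finset.sum_Ico_succ_top (by omega), ih, pow_succ]
      field_simp
      ring
  calc ∑ j ∈ Finset.Icc i L, ((2 : ℝ) ^ j)⁻¹ ≤ ∑ j ∈ Finset.Ico i (i + (L + 1)), ((2 : ℝ) ^ j)⁻¹ :=
        Finset.sum_le_sum_of_subset_of_nonneg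
          (fun j hj => by simp only [Finset.mem_Icc, Finset.mem_Ico] at *; omega)
          fun _ _ _ => by positivity
    _ ≤ 2 * (2 ^ i)⁻¹ := by
        rw [hstrong]
        have : (0 : ℝ) ≤ 2 * (2 ^ (i + (L + 1)))⁻¹ := by positivity
        linarith

/-- Talwar's randomized hierarchical decomposition of a finite doubling metric
space: a random sequence of successively coarser partitions, with singletons at
the bottom, the whole space at the top, diameter bound `2^i·γ` at level `i`,
branching factor at most `2^{5·ddim}`, and cutting probability at level `i`
at most `K·ddim·dist(x,y)/(2^i·γ)`. -/
theorem talwar_hierarchical_decomposition :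
    ∃ K : ℝ, 0 < K ∧
    ∀ (M : Type) [MetricSpace M] [Fintype M] [Nontrivial M],
    ∀ ddim : ℕ, 1 ≤ ddim →
    DoublingDimLE (Set.univ : Set M) ddim →
    ∃ p : PMF (ℕ → Finset (Finset M)),
      (∀ P ∈ p.support,
        -- each level is a partition of the whole space
        (∀ i ≤ ⌈Real.logb 2 (Metric.diam (Set.univ : Set M) / minSep M)⌉₊ + 1,
          IsPartitionOf Finset.univ (P i)) ∧
        -- (i) the top level is the trivial partition and the bottom level has singletons
        P (⌈Real.logb 2 (Metric.diam (Set.univ : Set M) / minSep M)⌉₊ + 1) = {Finset.univ} ∧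
        (∀ C ∈ P 0, C.card = 1) ∧
        -- (ii) each level refines the next, with branching factor at most 2^{5·ddim}
        (∀ i : ℕ, 1 ≤ i → i ≤ ⌈Real.logb 2 (Metric.diam (Set.univ : Set M) / minSep M)⌉₊ + 1 →
          (∀ C' ∈ P (i - 1), ∃ C ∈ P i, C' ⊆ C) ∧
          (∀ C ∈ P i, ∃ T : Finset (Finset M), T ⊆ P (i - 1) ∧ T.card ≤ 2 ^ (5 * ddim) ∧
            ∀ x : M, x ∈ C ↔ ∃ C' ∈ T, x ∈ C')) ∧
        -- (iii) diameter bound at each level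
        (∀ i ≤ ⌈Real.logb 2 (Metric.diam (Set.univ : Set M) / minSep M)⌉₊ + 1,
          ∀ C ∈ P i, Metric.diam (C : Set M) ≤ 2 ^ i * minSep M)) ∧
      -- (iv) cutting probability bound
      (∀ x y : M, ∀ i ≤ ⌈Real.logb 2 (Metric.diam (Set.univ : Set M) / minSep M)⌉₊ + 1,
        p.toOuterMeasure {P | ¬ ∃ C ∈ P i, x ∈ C ∧ y ∈ C} ≤
          ENNReal.ofReal (K * ddim * dist x y / (2 ^ i * minSep M))) := by
  classical
  refine ⟨50, by norm_num, ?_⟩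
  intro M _ _ _ D hD hdoub
  set L := ⌈Real.logb 2 (Metric.diam (Set.univ : Set M) / minSep M)⌉₊ with hL
  have hγ := minSep_pos M
  have hdist : ∀ x y : M, dist x y ≤ 2 ^ L * minSep M := dist_le_two_pow_mul_minSep
  choose f hfx hfsep hfcut using fun j : ℕ =>
    exists_random_clustering hD hdoub (2 ^ L) (s := 2 ^ j * minSep M) (by positivity)
  let Ω := (M ≃ Fin (Fintype.card M)) × Fin (2 ^ L)
  have : Nonempty Ω := ⟨(Fintype.equivFin M, ⟨0, by positivity⟩)⟩
  let P : Ω → ℕ → Finset (Finset M) := fun ω => labelClasses (fun j => f j ω) L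
  have hclose : ∀ (ω : Ω) (i : ℕ), i ≤ L → ∀ C ∈ P ω i, ∀ x ∈ C, ∀ y ∈ C,
      dist x y < 2 ^ i * minSep M := by
    intro ω i hi C hC x hx y hy
    have heq : f i ω x = f i ω y := label_eq_of_mem hC hx hy le_rfl hi
    have h1 := hfx i ω x
    have h2 := hfx i ω y
    rw [heq] at h1
    linarith [dist_triangle_left x y (f i ω y)]
  have hdiam : ∀ (ω : Ω) (i : ℕ), i ≤ L + 1 → ∀ C ∈ P ω i, ∀ x ∈ C, ∀ y ∈ C,
      dist x y ≤ 2 ^ i * minSep M := by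
    intro ω i hi C hC x hx y hy
    rcases hi.eq_or_lt with rfl | hlt
    · refine (hdist x y).trans ?_
      gcongr
      · norm_num
      · omega
    · exact (hclose ω i (by omega) C hC x hx y hy).le
  refine ⟨(PMF.uniformOfFintype Ω).map P, ?_, ?_⟩
  · intro Q hQ
    rw [PMF.mem_support_map_iff] at hQ
    obtain ⟨ω, -, rfl⟩ := hQ
    refine ⟨fun i _ => isPartitionOf_labelClasses _ L i, labelClasses_succ_self _ L, ?_, ?_, ?_⟩
    · intro C hC
      obtain ⟨x, hx⟩ := nonempty_of_mem_labelClasses hC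
      refine Finset.card_eq_one.2 ⟨x, Finset.eq_singleton_iff_unique_mem.2 ⟨hx, fun y hy => ?_⟩⟩
      by_contra hne
      have h1 := hclose ω 0 (Nat.zero_le _) C hC y hy x hx
      have h2 := minSep_le_dist hne
      rw [pow_zero, one_mul] at h1
      linarith
    · intro i hi1 hiL
      obtain ⟨i, rfl⟩ : ∃ k, i = k + 1 := ⟨i - 1, by omega⟩
      rw [Nat.add_sub_cancel]
      refine ⟨fun C' hC' => exists_superset_labelClasses hC', fun C hC => ?_⟩
      obtain ⟨T, hT, hcard, hmem⟩ := exists_children_labelClasses hC (by omega)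
      refine ⟨T, hT, hcard.trans ?_, hmem⟩
      obtain ⟨c, hc⟩ := nonempty_of_mem_labelClasses hC
      have hpos : 0 < 2 ^ i * minSep M := by positivity
      refine hdoub.card_le_of_separated c (r := 5 / 2 * (2 ^ i * minSep M)) (by positivity) 5 _
        ?_ ?_
      · intro z hz
        obtain ⟨x, hx, rfl⟩ := Finset.mem_image.1 hz
        have h1 := hdiam ω (i + 1) hiL C hC x hx c hc
        rw [pow_succ] at h1
        linarith [dist_triangle (f i ω x) x c, hfx i ω x]
      · intro z hz w hw hne
        obtain ⟨x, -, rfl⟩ := Finset.mem_image.1 hz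
        obtain ⟨y, -, rfl⟩ := Finset.mem_image.1 hw
        linarith [hfsep i ω x y hne]
    · intro i hi C hC
      exact Metric.diam_le_of_forall_dist_le (by positivity) fun x hx y hy =>
        hdiam ω i hi C hC x hx y hy
  · intro x y i hi
    rw [PMF.toOuterMeasure_map_apply, PMF.toOuterMeasure_uniformOfFintype_apply]
    have hΩ : (0 : ℝ) < Fintype.card Ω := by exact_mod_cast Fintype.card_pos
    let E : ℕ → Finset Ω := fun j => Finset.univ.filter fun ω => f j ω x ≠ f j ω y
    have hE : ∀ j ∈ Finset.Icc i L, ((E j).card : ℝ) ≤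
        25 * D * dist x y * Fintype.card Ω / minSep M * (2 ^ j)⁻¹ := by
      intro j hj
      rw [Finset.mem_Icc] at hj
      rcases eq_or_ne x y with rfl | hne
      · simp [E]
      · have hN : 2 ^ j * minSep M ≤ ((2 ^ L : ℕ) : ℝ) * dist x y := by
          push_cast
          exact mul_le_mul (pow_le_pow_right₀ one_le_two hj.2) (minSep_le_dist hne) hγ.le
            (by positivity)
        have := hfcut j x y hN
        rw [← div_eq_mul_inv, div_div, le_div_iff₀ (by positivity), mul_comm (minSep M)]
        exact this
    have hsub : (P ⁻¹' {Q | ¬ ∃ C ∈ Q i, x ∈ C ∧ y ∈ C}).toFinset ⊆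
        (Finset.Icc i L).biUnion E := by
      intro ω hω
      by_contra hcon
      simp only [Finset.mem_biUnion, Finset.mem_Icc, E, Finset.mem_filter, Finset.mem_univ,
        true_and, not_exists, not_and, not_not] at hcon
      rw [Set.mem_toFinset] at hω
      refine hω ?_
      obtain ⟨C, hC, hxC⟩ := exists_mem_labelClasses (fun j => f j ω) L i x
      exact ⟨C, hC, (hxC x).2 fun _ _ _ => rfl, (hxC y).2 fun j h1 h2 => hcon j ⟨h1, h2⟩⟩
    have hcard : (Fintype.card (P ⁻¹' {Q | ¬ ∃ C ∈ Q i, x ∈ C ∧ y ∈ C}) : ℝ) ≤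
        50 * D * dist x y / (2 ^ i * minSep M) * Fintype.card Ω := by
      rw [← Set.toFinset_card]
      calc _ ≤ ∑ j ∈ Finset.Icc i L, ((E j).card : ℝ) := by
            exact_mod_cast (Finset.card_le_card hsub).trans Finset.card_biUnion_le
        _ ≤ ∑ j ∈ Finset.Icc i L,
              25 * D * dist x y * Fintype.card Ω / minSep M * ((2 : ℝ) ^ j)⁻¹ :=
            Finset.sum_le_sum hE
        _ ≤ 25 * D * dist x y * Fintype.card Ω / minSep M * (2 * (2 ^ i)⁻¹) := by
            rw [← Finset.mul_sum]
            exact mul_le_mul_of_nonneg_left (sum_Icc_inv_two_pow_le i L) (by positivity)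
        _ = _ := by field_simp; ring
    refine ENNReal.div_le_of_le_mul ?_
    rw [← ENNReal.ofReal_natCast (Fintype.card Ω), ← ENNReal.ofReal_mul (by positivity),
      ← ENNReal.ofReal_natCast]
    exact ENNReal.ofReal_le_ofReal hcard
end

section
/- Let (X, dist) be a finite metric space with minimum interpoint distance γ and let ddim ≥ 1 and K > 0. Suppose μ is a probability distribution over sequences of partitions (P_0, …, P_{ℓ+1}) of X such that for every pair x, y ∈ X and every level 0 ≤ i ≤ ℓ+1, the probability that x and y lie in different parts of P_i is at most K·ddim·dist(x, y)/(2^i·γ). Then for every 0 < ε < 1 and every pair of distinct points x, x̂ ∈ X, the probability that there exists a level i ≥ log₂(ddim·dist(x, x̂)/(ε²·γ)) at which x and x̂ lie in different parts of P_i is at most 2·K·ε². -/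
open Metric

theorem sum_Ico_inv_two_pow_le (m n : ℕ) :
    ∑ i ∈ Finset.Ico m n, ((2 : ℝ) ^ i)⁻¹ ≤ 2 * (2 ^ m)⁻¹ := by
  rcases le_total n m with h | h
  · rw [Finset.Ico_eq_empty_of_le h, Finset.sum_empty]
    positivity
  · have key : ∑ i ∈ Finset.Ico m n, ((2 : ℝ) ^ i)⁻¹ = 2 * (2 ^ m)⁻¹ - 2 * (2 ^ n)⁻¹ := by
      induction n, h using Nat.le_induction with
      | base => simp
      | succ k hk ih =>
        rw [Finset.sum_Ico_succ_top hk, ih, pow_succ, mul_inv]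
        ring
    rw [key]
    exact sub_le_self _ (by positivity)

/-- The tail of the geometric series over the exponents `i` with `B ≤ 2 ^ i` is at most `2 / B`. -/
theorem sum_inv_two_pow_le_of_le {B : ℝ} (hB : 0 < B) (s : Finset ℕ)
    (hs : ∀ i ∈ s, B ≤ 2 ^ i) : ∑ i ∈ s, ((2 : ℝ) ^ i)⁻¹ ≤ 2 * B⁻¹ := by
  rcases s.eq_empty_or_nonempty with rfl | hne
  · rw [Finset.sum_empty]
    positivity
  · have hsub : s ⊆ Finset.Ico (s.min' hne) (s.max' hne + 1) := fun i hi =>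
      Finset.mem_Ico.2 ⟨s.min'_le i hi, Nat.lt_succ_of_le (s.le_max' i hi)⟩
    calc ∑ i ∈ s, ((2 : ℝ) ^ i)⁻¹
        ≤ ∑ i ∈ Finset.Ico (s.min' hne) (s.max' hne + 1), ((2 : ℝ) ^ i)⁻¹ :=
          Finset.sum_le_sum_of_subset_of_nonneg hsub fun _ _ _ => by positivity
      _ ≤ 2 * (2 ^ s.min' hne)⁻¹ := sum_Ico_inv_two_pow_le _ _
      _ ≤ 2 * B⁻¹ := by
          have := hs _ (s.min'_mem hne)
          gcongr

/-- Badly-cut probability: if a random sequence of partitions has cutting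
probability at most `K·ddim·dist(x,y)/(2^i·γ)` at each level `i`, then the
probability that a fixed pair `(x, xh)` is cut at some level
`i ≥ log₂(ddim·dist(x,xh)/(ε²·γ))` is at most `2·K·ε²`. -/
theorem badly_cut_probability {M : Type*} [MetricSpace M] [Fintype M] [Nontrivial M]
    (ddim : ℕ) (hddim : 1 ≤ ddim) (K : ℝ) (hK : 0 < K) (ℓ : ℕ)
    (p : PMF (ℕ → Finset (Finset M)))
    (hcut : ∀ x y : M, ∀ i : ℕ, i ≤ ℓ + 1 →
      p.toOuterMeasure {P | ¬ ∃ C ∈ P i, x ∈ C ∧ y ∈ C} ≤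
        ENNReal.ofReal (K * ddim * dist x y / (2 ^ i * minSep M)))
    (ε : ℝ) (hε0 : 0 < ε) (hε1 : ε < 1) (x xh : M) (hxx : x ≠ xh) :
    p.toOuterMeasure {P | ∃ i : ℕ, i ≤ ℓ + 1 ∧
        Real.logb 2 (ddim * dist x xh / (ε ^ 2 * minSep M)) ≤ (i : ℝ) ∧
        ¬ ∃ C ∈ P i, x ∈ C ∧ xh ∈ C} ≤
      ENNReal.ofReal (2 * K * ε ^ 2) := by
  have hγ := minSep_pos M
  have hd : 0 < dist x xh := dist_pos.2 hxx
  have hD : (0 : ℝ) < ddim := by exact_mod_cast hddim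
  set γ := minSep M
  set B : ℝ := ddim * dist x xh / (ε ^ 2 * γ) with hBdef
  have hB : 0 < B := by positivity
  classical
  set s : Finset ℕ := (Finset.range (ℓ + 2)).filter fun i => Real.logb 2 B ≤ (i : ℝ) with hsdef
  have hs : ∀ i ∈ s, B ≤ 2 ^ i := fun i hi => by
    have h := (Real.logb_le_iff_le_rpow one_lt_two hB).1 (Finset.mem_filter.1 hi).2
    rwa [Real.rpow_natCast] at h
  calc p.toOuterMeasure {P | ∃ i : ℕ, i ≤ ℓ + 1 ∧ Real.logb 2 B ≤ (i : ℝ) ∧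
          ¬ ∃ C ∈ P i, x ∈ C ∧ xh ∈ C}
      ≤ p.toOuterMeasure (⋃ i ∈ s, {P | ¬ ∃ C ∈ P i, x ∈ C ∧ xh ∈ C}) := by
        refine MeasureTheory.measure_mono ?_
        rintro P ⟨i, hi, hBi, hP⟩
        exact Set.mem_biUnion
          (Finset.mem_filter.2 ⟨Finset.mem_range.2 (Nat.lt_succ_of_le hi), hBi⟩) hP
    _ ≤ ∑ i ∈ s, p.toOuterMeasure {P | ¬ ∃ C ∈ P i, x ∈ C ∧ xh ∈ C} :=
        MeasureTheory.measure_biUnion_finset_le _ _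
    _ ≤ ∑ i ∈ s, ENNReal.ofReal (K * ddim * dist x xh / (2 ^ i * γ)) :=
        Finset.sum_le_sum fun i hi => hcut x xh i
          (Nat.le_of_lt_succ (Finset.mem_range.1 (Finset.mem_filter.1 hi).1))
    _ = ENNReal.ofReal (∑ i ∈ s, K * ddim * dist x xh / (2 ^ i * γ)) :=
        (ENNReal.ofReal_sum_of_nonneg fun _ _ => by positivity).symm
    _ ≤ ENNReal.ofReal (2 * K * ε ^ 2) := by
        refine ENNReal.ofReal_le_ofReal ?_
        calc ∑ i ∈ s, K * ddim * dist x xh / (2 ^ i * γ)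
            = K * ε ^ 2 * B * ∑ i ∈ s, ((2 : ℝ) ^ i)⁻¹ := by
              rw [Finset.mul_sum]
              refine Finset.sum_congr rfl fun i _ => ?_
              rw [hBdef]
              field_simp
          _ ≤ K * ε ^ 2 * B * (2 * B⁻¹) := by
              gcongr
              exact sum_inv_two_pow_le_of_le hB s hs
          _ = 2 * K * ε ^ 2 := by
              field_simp
end

section
/- Let X ⊂ ℝ^m be a finite point set and let F* ⊂ ℝ^m be a finite nonempty facility set that is optimal for the UFL problem on X with opening cost 1, i.e., cost(X, F*) ≤ cost(X, F) for every finite nonempty F ⊂ ℝ^m. Let Ĉ ⊆ X and z ∈ Ĉ be such that Σ_{y∈Ĉ} ‖y − z‖ > 1/2. Then there exists a facility f ∈ F* with ‖f − z‖ ≤ 4·diam(Ĉ), where diam(Ĉ) := max_{u,v∈Ĉ} ‖u − v‖. -/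
open Metric

noncomputable def uflCost {α M : Type*} [MetricSpace M]
    (f : α → M) (X : Finset α) (F : Finset M) : ℝ :=
  F.card + ∑ x ∈ X, Metric.infDist (f x) (F : Set M)

/-- If opening a facility at `z ∈ C` does not decrease the cost, and the total connection cost of
`C ⊆ X` to `z` exceeds `1 / 2`, then some open facility is within `4 * diam C` of `z`. -/
theorem exists_dist_le_four_mul_diam_of_le_uflCost_insert {M : Type*} [MetricSpace M]
    [DecidableEq M] {X F C : Finset M} {z : M} (hF : F.Nonempty)
    (hle : uflCost id X F ≤ uflCost id X (insert z F)) (hCX : C ⊆ X) (hz : z ∈ C)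
    (hheavy : 1 / 2 < ∑ y ∈ C, dist y z) :
    ∃ f ∈ F, dist f z ≤ 4 * Metric.diam (C : Set M) := by
  by_contra! hfar
  have hFne : (F : Set M).Nonempty := by exact_mod_cast hF
  have saving : ∀ y ∈ C, 2 * dist y z ≤
      Metric.infDist y (F : Set M) - Metric.infDist y (insert z F : Finset M) := by
    intro y hy
    have hdiam : dist y z ≤ Metric.diam (C : Set M) :=
      Metric.dist_le_diam_of_mem C.finite_toSet.isBounded (by exact_mod_cast hy)
        (by exact_mod_cast hz)
    have hnew : Metric.infDist y (insert z F : Finset M) ≤ dist y z :=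
      Metric.infDist_le_dist_of_mem (by simp)
    have hold : 3 * dist y z ≤ Metric.infDist y (F : Set M) := by
      refine (Metric.le_infDist hFne).2 fun f hf ↦ ?_
      have := hfar f (by exact_mod_cast hf)
      linarith [dist_triangle f y z, dist_comm f y]
    linarith
  have saving_nonneg : ∀ x, 0 ≤
      Metric.infDist x (F : Set M) - Metric.infDist x (insert z F : Finset M) := fun x ↦
    sub_nonneg.2 (Metric.infDist_le_infDist_of_subset (by simp) hFne)
  have hsum := (Finset.sum_le_sum saving).trans
    (Finset.sum_le_sum_of_subset_of_nonneg hCX fun x _ _ ↦ saving_nonneg x)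
  rw [← Finset.mul_sum, Finset.sum_sub_distrib] at hsum
  have hcard : ((insert z F).card : ℝ) ≤ F.card + 1 := by
    exact_mod_cast Finset.card_insert_le z F
  simp only [uflCost, id] at hle
  linarith

/-- Locality of optimal facilities: if `F*` is an optimal UFL solution for `X`
(opening cost 1) and `Ĉ ⊆ X` has total connection cost to `z ∈ Ĉ` greater than
`1/2`, then some optimal facility lies within distance `4·diam(Ĉ)` of `z`. -/
theorem locality_of_optimal_facilities (m : ℕ)
    (X : Finset (EuclideanSpace ℝ (Fin m)))
    (Fstar : Finset (EuclideanSpace ℝ (Fin m))) (hF : Fstar.Nonempty)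
    (hopt : ∀ F : Finset (EuclideanSpace ℝ (Fin m)), F.Nonempty →
      uflCost id X Fstar ≤ uflCost id X F)
    (Chat : Finset (EuclideanSpace ℝ (Fin m))) (hCX : Chat ⊆ X)
    (z : EuclideanSpace ℝ (Fin m)) (hz : z ∈ Chat)
    (hheavy : 1 / 2 < ∑ y ∈ Chat, dist y z) :
    ∃ f ∈ Fstar, dist f z ≤ 4 * Metric.diam (Chat : Set (EuclideanSpace ℝ (Fin m))) := by
  classical
  exact exists_dist_le_four_mul_diam_of_le_uflCost_insert hF
    (hopt _ (Finset.insert_nonempty _ _)) hCX hz hheavy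
end

section
/- Let (x_1, …, x_n) be a finite sequence of points in ℝ^m, let φ : ℝ^m → ℝ^{d′} be any map, let t > 0, and let 0 < θ ≤ 1/100. Suppose the (1+t)-expansion graph of the sequence with respect to φ — the graph on vertex set {1, …, n} with an edge (i, j) whenever ‖φ(x_i) − φ(x_j)‖ ≥ (1+t)·‖x_i − x_j‖ — has maximum degree at most θ·n. Then med₁(φ(x_1), …, φ(x_n)) ≤ (1+t)·(1+√θ)·med₁(x_1, …, x_n). -/
open Metric

/-- 1-median value of a finite sequence of points (with multiplicities). -/
noncomputable def med1 {M : Type*} [MetricSpace M] {n : ℕ} (p : Fin n → M) : ℝ :=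
  ⨅ f : M, ∑ i, dist (p i) f

open Finset in
/-- Weighted sum of pairwise squared distances, expressed through an arbitrary base point. -/
theorem sum_sum_mul_norm_sub_sq {ι E : Type*} [Fintype ι] [NormedAddCommGroup E]
    [InnerProductSpace ℝ E] (w : ι → ℝ) (p : ι → E) (c : E) :
    ∑ i, ∑ j, w i * w j * ‖p i - p j‖ ^ 2
      = 2 * (∑ i, w i) * ∑ i, w i * ‖p i - c‖ ^ 2 - 2 * ‖∑ i, w i • (p i - c)‖ ^ 2 := by
  have key : ∀ i j, w i * w j * ‖p i - p j‖ ^ 2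
      = w j * (w i * ‖p i - c‖ ^ 2) + w i * (w j * ‖p j - c‖ ^ 2)
        - 2 * inner ℝ (w i • (p i - c)) (w j • (p j - c)) := by
    intro i j
    have h : p i - p j = (p i - c) - (p j - c) := by abel
    rw [h, norm_sub_sq_real, real_inner_smul_left, real_inner_smul_right]
    ring
  have hin : ‖∑ i, w i • (p i - c)‖ ^ 2
      = ∑ i, ∑ j, inner ℝ (w i • (p i - c)) (w j • (p j - c)) := by
    rw [← real_inner_self_eq_norm_sq, sum_inner]
    simp_rw [inner_sum]
  rw [hin]
  simp_rw [key, sum_sub_distrib, sum_add_distrib, ← mul_sum, ← sum_mul, ← mul_sum]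
  ring

theorem med1_le_sum_dist {M : Type*} [MetricSpace M] {n : ℕ} (p : Fin n → M) (f : M) :
    med1 p ≤ ∑ i, dist (p i) f :=
  ciInf_le ⟨0, by rintro _ ⟨g, rfl⟩; positivity⟩ f

open Finset in
/-- A quantile: at least `a` values lie weakly below it, at most `a` strictly below. -/
theorem exists_quantile {ι : Type*} [Fintype ι] (r : ι → ℝ) (a : ℝ) (ha : 0 ≤ a)
    (hcard : a < Fintype.card ι) :
    ∃ i₀, a < #{k | r k ≤ r i₀} ∧ (#{k | r k < r i₀} : ℝ) ≤ a := by
  classical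
  have hne : Nonempty ι := by
    rw [← Fintype.card_pos_iff]
    exact_mod_cast ha.trans_lt hcard
  obtain ⟨m, -, hm⟩ := exists_max_image univ r univ_nonempty
  have hm' : m ∈ ({i | a < #{k | r k ≤ r i}} : Finset ι) := by
    rw [mem_filter_univ, filter_true_of_mem fun k hk => hm k hk]
    simpa using hcard
  obtain ⟨i₀, hi₀, hmin⟩ := exists_min_image _ r ⟨m, hm'⟩
  refine ⟨i₀, by simpa using hi₀, ?_⟩
  by_contra! hlt
  have hpos : 0 < #{k | r k < r i₀} := by exact_mod_cast ha.trans_lt hlt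
  obtain ⟨l, hl, hlmax⟩ := exists_max_image _ r (card_pos.1 hpos)
  have hl' : r l < r i₀ := by simpa using hl
  refine absurd (hmin l ?_) (not_le.2 hl')
  rw [mem_filter_univ]
  refine hlt.trans_le ?_
  exact_mod_cast card_le_card fun k hk => by
    rw [mem_filter_univ]
    exact hlmax k hk

/-- Contribution of an expanded pair, split into the contributions of its two endpoints. -/
theorem weight_mul_sq_le {a b s ρ G : ℝ} (hs : 0 ≤ s) (hρ : 0 < ρ) (ha : s ≤ a) (hb : s ≤ b)
    (hG : ∀ r, s ≤ r → (r + s) / (r + ρ) ≤ G) :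
    (a + ρ)⁻¹ * (b + ρ)⁻¹ * (a + b + 2 * s) ^ 2
      ≤ (G * (a + s) / (s + ρ) + G ^ 2) + (G * (b + s) / (s + ρ) + G ^ 2) := by
  have main : ∀ c d : ℝ, s ≤ c → s ≤ d →
      (c + s) / (c + ρ) * ((c + s) / (d + ρ)) ≤ G * (c + s) / (s + ρ) := by
    intro c d hc hd
    rw [mul_div_assoc]
    have h1 := hG c hc
    have h0 : 0 ≤ (c + s) / (c + ρ) := div_nonneg (by linarith) (by linarith)
    have h2 : (c + s) / (d + ρ) ≤ (c + s) / (s + ρ) :=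
      div_le_div_of_nonneg_left (by linarith) (by linarith) (by linarith)
    exact mul_le_mul h1 h2 (div_nonneg (by linarith) (by linarith)) (h0.trans h1)
  have ga := hG a ha
  have gb := hG b hb
  have ga0 : 0 ≤ (a + s) / (a + ρ) := div_nonneg (by linarith) (by linarith)
  have gb0 : 0 ≤ (b + s) / (b + ρ) := div_nonneg (by linarith) (by linarith)
  have hab := mul_le_mul ga gb gb0 (ga0.trans ga)
  have m1 := main a b ha hb
  have m2 := main b a hb ha
  have hne1 : a + ρ ≠ 0 := by linarith
  have hne2 : b + ρ ≠ 0 := by linarith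
  have hid : (a + ρ)⁻¹ * (b + ρ)⁻¹ * (a + b + 2 * s) ^ 2
      = (a + s) / (a + ρ) * ((a + s) / (b + ρ)) + (b + s) / (b + ρ) * ((b + s) / (a + ρ))
        + 2 * ((a + s) / (a + ρ) * ((b + s) / (b + ρ))) := by
    field_simp
    ring
  rw [hid]
  nlinarith

/-- A uniform bound on `(r + s) / (r + ρ)` for `r ≥ s`, small enough for the total of the
endpoint contributions. -/
theorem exists_ratio_bound {s ρ A u : ℝ} (hs : 0 ≤ s) (hA : 0 < A) (hu : 0 < u)
    (hu' : u ≤ 1 / 10) (hρ : ρ = u * A) :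
    ∃ G : ℝ, (∀ r, s ≤ r → (r + s) / (r + ρ) ≤ G) ∧
      ρ * (G * (A + s) / (s + ρ) + G ^ 2) ≤ (1 + 2 * u) * A := by
  have hρ0 : 0 < ρ := hρ ▸ mul_pos hu hA
  have hsρ : 0 < s + ρ := by linarith
  rcases le_total s ρ with h | h
  · refine ⟨1, fun r hr => (div_le_one (by linarith)).2 (by linarith), ?_⟩
    have : ρ * ((A + s) / (s + ρ)) ≤ (1 + u) * A := by
      rw [← mul_div_assoc, div_le_iff₀ hsρ]
      subst hρ
      nlinarith [mul_nonneg hs hA.le, mul_pos (mul_pos hu hA) (mul_pos hu hA), mul_pos hu hA,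
        mul_nonneg hu.le (mul_nonneg hs hA.le), sq_nonneg (u * A)]
    rw [one_mul, one_pow, mul_add]
    nlinarith
  · refine ⟨2 * s / (s + ρ), fun r hr => ?_, ?_⟩
    · rw [div_le_div_iff₀ (by linarith) hsρ]
      nlinarith [mul_nonneg (sub_nonneg.2 hr) (sub_nonneg.2 h)]
    · have hid : ρ * (2 * s / (s + ρ) * (A + s) / (s + ρ) + (2 * s / (s + ρ)) ^ 2)
          = ρ * (2 * s * (A + s) + 4 * s ^ 2) / (s + ρ) ^ 2 := by
        field_simp
        ring
      rw [hid, div_le_iff₀ (by positivity)]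
      subst hρ
      have h1 : 0 ≤ A * (s ^ 2 * (1 - 4 * u)) :=
        mul_nonneg hA.le (mul_nonneg (sq_nonneg s) (by linarith))
      have h2 : 0 ≤ u * A * (s * A) * u := by positivity
      have h3 : 0 ≤ A * (u * A) ^ 2 * (1 + 2 * u) := by positivity
      nlinarith

theorem quadratic_budget {u L : ℝ} (hu : 0 < u) (hu' : u ≤ 1 / 10) (hL : u ≤ L * (1 + u))
    (hL1 : L ≤ 1) :
    (1 + u) * (1 - u + u * L + u ^ 2 * (1 + 2 * u) / L) ≤ ((1 + u) * (1 - 2 * u ^ 2)) ^ 2 := by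
  have hL0 : 0 < L := by
    by_contra! h
    nlinarith
  have h1 : 1 - u + u * L + u ^ 2 * (1 + 2 * u) / L ≤ (1 + u) * (1 - 2 * u ^ 2) ^ 2 := by
    have : u * L ^ 2 + u ^ 2 * (1 + 2 * u)
        ≤ ((1 + u) * (1 - 2 * u ^ 2) ^ 2 - (1 - u)) * L := by
      have hq : 0 ≤ (1 - L) * (L * (1 + u) - u) :=
        mul_nonneg (by linarith) (by linarith)
      have h4 : u * (u * (3 * u + 2 * u ^ 2)) ≤ L * (1 + u) * (u * (3 * u + 2 * u ^ 2)) := by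
        gcongr
      have h5 : 0 ≤ u * L * (1 - 7 * u - 13 * u ^ 2 - 6 * u ^ 3) := by
        have h6 : u ^ 2 ≤ (1 / 10) ^ 2 := by gcongr
        have h7 : u ^ 3 ≤ (1 / 10) ^ 3 := by gcongr
        exact mul_nonneg (by positivity) (by linarith)
      have h8 : 0 ≤ L * (1 + u) * (4 * u ^ 4 + 4 * u ^ 5) := by positivity
      refine le_of_mul_le_mul_left ?_ (by linarith : 0 < 1 + u)
      linarith [mul_nonneg hu.le hq]
    have h2 : u ^ 2 * (1 + 2 * u) / L ≤ (1 + u) * (1 - 2 * u ^ 2) ^ 2 - (1 - u) - u * L := by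
      rw [div_le_iff₀ hL0]
      nlinarith
    linarith
  calc _ ≤ (1 + u) * ((1 + u) * (1 - 2 * u ^ 2) ^ 2) := by gcongr
    _ = _ := by ring

open Finset in
/-- The quantitative core: if all pairwise distances of `y` are controlled by those of `x`, except
for pairs of a sparse relation, where only a bound through the radii `R` is available, then some
point has small total distance to `y`. -/
theorem exists_sum_dist_le {ι E F : Type*} [Fintype ι] [Nonempty ι]
    [NormedAddCommGroup E] [InnerProductSpace ℝ E] [NormedAddCommGroup F] [InnerProductSpace ℝ F]
    (x : ι → E) (y : ι → F) (f : E) (R : ι → ℝ) (s τ u : ℝ) (adj : ι → ι → Prop)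
    [DecidableRel adj] (hsymm : ∀ i j, adj i j → adj j i) (hτ : 0 < τ) (hu : 0 < u)
    (hu' : u ≤ 1 / 10) (hs : 0 ≤ s) (hsR : ∀ i, s ≤ R i) (hR : 0 < ∑ i, R i)
    (hxR : ∀ i, dist (x i) f ≤ R i)
    (hdeg : ∀ i, (#{j | adj i j} : ℝ) ≤ u ^ 2 * Fintype.card ι)
    (hnadj : ∀ i j, ¬ adj i j → dist (y i) (y j) ≤ τ * dist (x i) (x j))
    (hadj : ∀ i j, adj i j → dist (y i) (y j) ≤ τ * (R i + R j + 2 * s)) :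
    ∃ v, ∑ i, dist (y i) v ≤ τ * ((1 + u) * (1 - 2 * u ^ 2)) * ∑ i, R i := by
  set T := ∑ i, R i with hT
  set N : ℝ := (Fintype.card ι : ℝ) with hN
  have hN0 : 0 < N := by
    rw [hN]
    exact_mod_cast Fintype.card_pos
  obtain ⟨ρ, hρ⟩ : ∃ ρ, ρ = u * (T / N) := ⟨_, rfl⟩
  have hρ0 : 0 < ρ := by rw [hρ]; positivity
  have hρN : N * ρ = u * T := by rw [hρ]; field_simp
  obtain ⟨G, hG, hGle⟩ := exists_ratio_bound hs (div_pos hR hN0)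
    hu hu' hρ
  have hRρ : ∀ i, 0 < R i + ρ := fun i => by linarith [hsR i]
  set w : ι → ℝ := fun i => (R i + ρ)⁻¹ with hw
  have hw0 : ∀ i, 0 < w i := fun i => inv_pos.2 (hRρ i)
  set W := ∑ i, w i with hW
  have hW0 : 0 < W := sum_pos (fun i _ => hw0 i) univ_nonempty
  have hsumRρ : ∑ i, (R i + ρ) = T * (1 + u) := by
    rw [sum_add_distrib, sum_const, card_univ, nsmul_eq_mul, ← hN, hρN, ← hT]
    ring
  set c : ι → ℝ := fun i => G * (R i + s) / (s + ρ) + G ^ 2 with hc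
  have hc_nonneg : ∀ i, 0 ≤ c i := fun i => by
    have : 0 ≤ G := le_trans (div_nonneg (by linarith [hsR i]) (hRρ i).le) (hG (R i) (hsR i))
    have := hsR i
    have : 0 ≤ R i + s := by linarith
    positivity
  have hcsum : ρ * ∑ i, c i ≤ (1 + 2 * u) * T := by
    have h1 : ∑ i, c i = N * (G * (T / N + s) / (s + ρ) + G ^ 2) := by
      simp only [hc, sum_add_distrib, ← sum_div, ← mul_sum, sum_const, card_univ, nsmul_eq_mul,
        ← hN, ← hT]
      field_simp
    rw [h1]
    calc _ = N * (ρ * (G * (T / N + s) / (s + ρ) + G ^ 2)) := by ring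
      _ ≤ N * ((1 + 2 * u) * (T / N)) := by gcongr
      _ = _ := by field_simp
  have hwR : ∑ i, w i * R i ^ 2 = T - N * ρ + ρ ^ 2 * W := by
    have : ∀ i, w i * R i ^ 2 = R i - ρ + ρ ^ 2 * w i := fun i => by
      have := (hRρ i).ne'
      simp only [hw]
      field_simp
      ring
    simp_rw [this, sum_add_distrib, sum_sub_distrib, ← mul_sum]
    simp [hN, hT, hW]
  have hpair : ∀ i j, w i * w j * ‖y i - y j‖ ^ 2 ≤ τ ^ 2 * (w i * w j * ‖x i - x j‖ ^ 2
      + ((if adj i j then c i else 0) + if adj i j then c j else 0)) := by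
    intro i j
    have hij : 0 < w i * w j := mul_pos (hw0 i) (hw0 j)
    by_cases h : adj i j
    · have h1 := hadj i j h
      rw [dist_eq_norm] at h1
      have h2 : ‖y i - y j‖ ^ 2 ≤ (τ * (R i + R j + 2 * s)) ^ 2 := by gcongr
      have h3 := weight_mul_sq_le hs hρ0 (hsR i) (hsR j) hG
      simp only [h, if_true]
      calc _ ≤ w i * w j * (τ * (R i + R j + 2 * s)) ^ 2 := by gcongr
        _ = τ ^ 2 * (w i * w j * (R i + R j + 2 * s) ^ 2) := by ring
        _ ≤ τ ^ 2 * (c i + c j) := by gcongr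
        _ ≤ _ := mul_le_mul_of_nonneg_left (le_add_of_nonneg_left (by positivity)) (sq_nonneg τ)
    · have h1 := hnadj i j h
      rw [dist_eq_norm, dist_eq_norm] at h1
      simp only [h, if_false, add_zero]
      calc _ ≤ w i * w j * (τ * ‖x i - x j‖) ^ 2 := by gcongr
        _ = _ := by ring
  have hedge1 : ∑ i, ∑ j, (if adj i j then c i else 0) ≤ u ^ 2 * N * ∑ i, c i := by
    rw [mul_sum]
    refine sum_le_sum fun i _ => ?_
    rw [← sum_filter, sum_const, nsmul_eq_mul]
    exact mul_le_mul_of_nonneg_right (hdeg i) (hc_nonneg i)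
  have hedge2 : ∑ i, ∑ j, (if adj i j then c j else 0) = ∑ i, ∑ j, if adj i j then c i else 0 := by
    rw [sum_comm]
    exact sum_congr rfl fun i _ => sum_congr rfl fun j _ =>
      if_congr ⟨hsymm _ _, hsymm _ _⟩ rfl rfl
  have hxsum : ∑ i, ∑ j, w i * w j * ‖x i - x j‖ ^ 2 ≤ 2 * W * ∑ i, w i * R i ^ 2 := by
    rw [sum_sum_mul_norm_sub_sq w x f]
    have : ∑ i, w i * ‖x i - f‖ ^ 2 ≤ ∑ i, w i * R i ^ 2 := by
      refine sum_le_sum fun i _ => mul_le_mul_of_nonneg_left ?_ (hw0 i).le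
      have := hxR i
      rw [dist_eq_norm] at this
      gcongr
    have : 2 * W * ∑ i, w i * ‖x i - f‖ ^ 2 ≤ 2 * W * ∑ i, w i * R i ^ 2 := by gcongr
    have := sq_nonneg ‖∑ i, w i • (x i - f)‖
    linarith
  set v : F := W⁻¹ • ∑ i, w i • y i with hv
  have hv0 : ∑ i, w i • (y i - v) = 0 := by
    simp_rw [smul_sub, sum_sub_distrib, ← sum_smul]
    rw [← hW, hv, smul_inv_smul₀ hW0.ne', sub_self]
  have hysum : ∑ i, ∑ j, w i * w j * ‖y i - y j‖ ^ 2 = 2 * W * ∑ i, w i * ‖y i - v‖ ^ 2 := by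
    rw [sum_sum_mul_norm_sub_sq w y v, hv0]
    simp [hW]
  set Q := ∑ i, w i * ‖y i - v‖ ^ 2 with hQ
  have hQle : 2 * W * Q ≤ τ ^ 2 * (2 * W * (T - N * ρ + ρ ^ 2 * W)
      + 2 * (u ^ 2 * N * ∑ i, c i)) := by
    rw [← hysum, ← hwR]
    calc _ ≤ ∑ i, ∑ j, τ ^ 2 * (w i * w j * ‖x i - x j‖ ^ 2
          + ((if adj i j then c i else 0) + if adj i j then c j else 0)) :=
          sum_le_sum fun i _ => sum_le_sum fun j _ => hpair i j
      _ = τ ^ 2 * (∑ i, ∑ j, w i * w j * ‖x i - x j‖ ^ 2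
          + (∑ i, ∑ j, (if adj i j then c i else 0)
            + ∑ i, ∑ j, if adj i j then c j else 0)) := by
          simp_rw [← mul_sum, sum_add_distrib]
      _ ≤ _ := by
          gcongr
          linarith
  obtain ⟨L, hL⟩ : ∃ L, L = ρ * W / N := ⟨_, rfl⟩
  have hL0 : 0 < L := by rw [hL]; positivity
  have hLN : ρ * W = L * N := by rw [hL]; field_simp
  have hL1 : L ≤ 1 := by
    rw [hL, div_le_one hN0, hW, mul_sum]
    calc _ ≤ ∑ _i : ι, (1 : ℝ) := sum_le_sum fun i _ => by
          simp only [hw]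
          rw [← div_eq_mul_inv, div_le_one (hRρ i)]
          linarith [hsR i]
      _ = N := by simp [hN]
  have hLu : u ≤ L * (1 + u) := by
    have hcs := sum_sq_le_sum_mul_sum_of_sq_le_mul univ (r := fun _ : ι => (1 : ℝ))
      (fun i _ => (hw0 i).le) (fun i _ => (hRρ i).le)
      (fun i _ => by simp only [hw]; rw [inv_mul_cancel₀ (hRρ i).ne', one_pow])
    simp only [sum_const, card_univ, nsmul_eq_mul, mul_one] at hcs
    rw [hsumRρ, ← hN, ← hW] at hcs
    have h1 : u * N ^ 2 ≤ L * (1 + u) * N ^ 2 := by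
      calc u * N ^ 2 ≤ u * (W * (T * (1 + u))) := by gcongr
        _ = (N * ρ) * W * (1 + u) := by rw [hρN]; ring
        _ = N * (ρ * W) * (1 + u) := by ring
        _ = _ := by rw [hLN]; ring
    exact le_of_mul_le_mul_right h1 (by positivity)
  have hQ' : Q ≤ τ ^ 2 * (T * (1 - u + u * L + u ^ 2 * (1 + 2 * u) / L)) := by
    have h1 : Q ≤ τ ^ 2 * ((T - N * ρ + ρ ^ 2 * W) + u ^ 2 * N * (∑ i, c i) / W) := by
      have : 2 * W * Q ≤ 2 * W * (τ ^ 2 * ((T - N * ρ + ρ ^ 2 * W)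
          + u ^ 2 * N * (∑ i, c i) / W)) := by
        refine hQle.trans_eq ?_
        field_simp
      exact le_of_mul_le_mul_left this (by positivity)
    refine h1.trans (mul_le_mul_of_nonneg_left ?_ (by positivity))
    have h2 : T - N * ρ + ρ ^ 2 * W = T * (1 - u + u * L) := by
      have : ρ ^ 2 * W = (N * ρ) * L := by rw [sq, mul_assoc, hLN]; ring
      rw [this, hρN]
      ring
    have h3 : u ^ 2 * N * (∑ i, c i) / W ≤ T * (u ^ 2 * (1 + 2 * u) / L) := by
      have : u ^ 2 * N * (∑ i, c i) / W = u ^ 2 * (ρ * ∑ i, c i) / L := by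
        rw [hL]
        field_simp
      rw [this]
      calc _ ≤ u ^ 2 * ((1 + 2 * u) * T) / L := by gcongr
        _ = _ := by ring
    rw [h2]
    linarith
  refine ⟨v, ?_⟩
  have hcs := sum_sq_le_sum_mul_sum_of_sq_le_mul univ (r := fun i => ‖y i - v‖)
    (f := fun i => w i * ‖y i - v‖ ^ 2) (g := fun i => R i + ρ)
    (fun i _ => mul_nonneg (hw0 i).le (sq_nonneg _)) (fun i _ => (hRρ i).le)
    (fun i _ => by
      have := (hRρ i).ne'
      simp only [hw]
      field_simp
      rfl)
  rw [hsumRρ, ← hQ] at hcs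
  simp_rw [dist_eq_norm]
  have hfac : 0 ≤ 1 - 2 * u ^ 2 := by nlinarith
  refine le_of_sq_le_sq ?_ (by positivity)
  calc _ ≤ Q * (T * (1 + u)) := hcs
    _ ≤ τ ^ 2 * (T * (1 - u + u * L + u ^ 2 * (1 + 2 * u) / L)) * (T * (1 + u)) := by gcongr
    _ = τ ^ 2 * T ^ 2 * ((1 + u) * (1 - u + u * L + u ^ 2 * (1 + 2 * u) / L)) := by ring
    _ ≤ τ ^ 2 * T ^ 2 * ((1 + u) * (1 - 2 * u ^ 2)) ^ 2 := by
        gcongr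
        exact quadratic_budget hu hu' hLu hL1
    _ = _ := by ring

open Finset in
/-- Replacing the values below a `2u²`-quantile `s` by `s` increases the sum by a factor of at most
`(1 - 2u²)⁻¹`. -/
theorem sum_max_quantile_le {ι : Type*} [Fintype ι] (r : ι → ℝ) (s a : ℝ) (ha : 0 ≤ a)
    (hr : ∀ i, 0 ≤ r i) (hs : 0 ≤ s) (hcard : (#{k | r k < s} : ℝ) ≤ a * Fintype.card ι) :
    (1 - a) * ∑ i, max (r i) s ≤ ∑ i, r i := by
  have h1 : ∑ i, max (r i) s ≤ ∑ i, r i + #{k | r k < s} * s := by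
    rw [← nsmul_eq_mul, ← sum_const, sum_filter, ← sum_add_distrib]
    refine sum_le_sum fun i _ => ?_
    split_ifs with h
    · exact max_le (by linarith) (by linarith [hr i])
    · simpa using h
  have h2 : Fintype.card ι * s ≤ ∑ i, max (r i) s := by
    simpa using card_nsmul_le_sum univ (fun i => max (r i) s) s fun i _ => le_max_right _ _
  have h3 := mul_le_mul_of_nonneg_right hcard hs
  have h4 := mul_le_mul_of_nonneg_left h2 ha
  linarith

open Finset in
/-- The expansion bound against an arbitrary center `f` and positive upper bounds `r i` for the
distances to it. -/
theorem exists_sum_dist_le_of_sparse {ι E F : Type*} [Fintype ι] [Nonempty ι]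
    [NormedAddCommGroup E] [InnerProductSpace ℝ E] [NormedAddCommGroup F] [InnerProductSpace ℝ F]
    (x : ι → E) (y : ι → F) (f : E) (r : ι → ℝ) (τ u : ℝ) (adj : ι → ι → Prop)
    (hsymm : ∀ i j, adj i j → adj j i) (hτ : 0 < τ) (hu : 0 < u) (hu' : u ≤ 1 / 10)
    (hr : ∀ i, 0 < r i) (hxr : ∀ i, dist (x i) f ≤ r i)
    (hdeg : ∀ i, ({j | adj i j}.ncard : ℝ) ≤ u ^ 2 * Fintype.card ι)
    (hnadj : ∀ i j, ¬ adj i j → dist (y i) (y j) ≤ τ * dist (x i) (x j)) :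
    ∃ v, ∑ i, dist (y i) v ≤ τ * (1 + u) * ∑ i, r i := by
  classical
  have hdeg' : ∀ i, (#{j | adj i j} : ℝ) ≤ u ^ 2 * Fintype.card ι := fun i => by
    have := hdeg i
    rwa [Set.ncard_eq_toFinset_card', Set.toFinset_ofPred] at this
  have hN : (0 : ℝ) < Fintype.card ι := by exact_mod_cast Fintype.card_pos
  have hu2 : 2 * u ^ 2 < 1 := by nlinarith
  obtain ⟨i₀, hle, hlt⟩ := exists_quantile r (2 * u ^ 2 * Fintype.card ι) (by positivity)
    (by nlinarith)
  set s := r i₀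
  have hs : 0 < s := hr i₀
  have hsum := sum_max_quantile_le r s (2 * u ^ 2) (by positivity) (fun i => (hr i).le) hs.le hlt
  have hmid : ∀ i j, ∃ k, r k ≤ s ∧ ¬ adj i k ∧ ¬ adj j k := by
    intro i j
    by_contra! h
    have hsub : ({k | r k ≤ s} : Finset ι) ⊆
        ({k | adj i k} : Finset ι) ∪ ({k | adj j k} : Finset ι) := fun k hk => by
      rw [mem_filter_univ] at hk
      rw [mem_union, mem_filter_univ, mem_filter_univ]
      exact or_iff_not_imp_left.2 (h k hk)
    have h1 : (#{k | r k ≤ s} : ℝ) ≤ #{k | adj i k} + #{k | adj j k} := by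
      exact_mod_cast (card_le_card hsub).trans (card_union_le _ _)
    linarith [hdeg' i, hdeg' j]
  have hx : ∀ i k, r k ≤ s → dist (x i) (x k) ≤ max (r i) s + s := fun i k hk => by
    have := dist_triangle_right (x i) (x k) f
    linarith [hxr i, hxr k, le_max_left (r i) s]
  obtain ⟨v, hv⟩ := exists_sum_dist_le x y f (fun i => max (r i) s) s τ u adj hsymm hτ hu hu' hs.le
    (fun i => le_max_right _ _)
    (sum_pos (fun i _ => lt_max_of_lt_left (hr i)) univ_nonempty)
    (fun i => (hxr i).trans (le_max_left _ _)) hdeg' hnadj (fun i j _ => by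
      obtain ⟨k, hk, hik, hjk⟩ := hmid i j
      calc dist (y i) (y j) ≤ dist (y i) (y k) + dist (y j) (y k) := dist_triangle_right _ _ _
        _ ≤ τ * dist (x i) (x k) + τ * dist (x j) (x k) :=
            add_le_add (hnadj i k hik) (hnadj j k hjk)
        _ ≤ τ * (max (r i) s + s) + τ * (max (r j) s + s) := by
            gcongr
            exacts [hx i k hk, hx j k hk]
        _ = _ := by ring)
  refine ⟨v, hv.trans ?_⟩
  calc _ = τ * (1 + u) * ((1 - 2 * u ^ 2) * ∑ i, max (r i) s) := by ring
    _ ≤ _ := by gcongr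

/-- If the `(1+t)`-expansion graph of a point sequence with respect to a map
`φ` has maximum degree at most `θ·n` (for `θ ≤ 1/100`), then the 1-median value
of the image is at most `(1+t)(1+√θ)` times that of the original sequence. -/
theorem med1_of_sparse_expansion_graph (m d' n : ℕ)
    (x : Fin n → EuclideanSpace ℝ (Fin m))
    (φ : EuclideanSpace ℝ (Fin m) → EuclideanSpace ℝ (Fin d'))
    (t θ : ℝ) (ht : 0 < t) (hθ0 : 0 < θ) (hθ : θ ≤ 1 / 100)
    (hsparse : ∀ i : Fin n,
      (({j : Fin n | j ≠ i ∧
          (1 + t) * dist (x i) (x j) ≤ dist (φ (x i)) (φ (x j))} : Set (Fin n)).ncard : ℝ)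
        ≤ θ * n) :
    med1 (fun i => φ (x i)) ≤ (1 + t) * (1 + Real.sqrt θ) * med1 x := by
  rcases Nat.eq_zero_or_pos n with rfl | hn
  · simp [med1]
  have : Nonempty (Fin n) := ⟨⟨0, hn⟩⟩
  have hn' : (0 : ℝ) < n := by exact_mod_cast hn
  have hu : 0 < Real.sqrt θ := Real.sqrt_pos.2 hθ0
  have hu' : Real.sqrt θ ≤ 1 / 10 := Real.sqrt_le_iff.2 ⟨by norm_num, by linarith⟩
  have hC : 0 < (1 + t) * (1 + Real.sqrt θ) := by positivity
  rw [← div_le_iff₀' hC]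
  refine le_ciInf fun f => ?_
  rw [div_le_iff₀' hC]
  have hε : ∀ ε > 0, med1 (fun i => φ (x i))
      ≤ (1 + t) * (1 + Real.sqrt θ) * (∑ i, dist (x i) f + n * ε) := by
    intro ε hε
    obtain ⟨v, hv⟩ := exists_sum_dist_le_of_sparse x (fun i => φ (x i)) f
      (fun i => dist (x i) f + ε) (1 + t) (Real.sqrt θ)
      (fun i j => j ≠ i ∧ (1 + t) * dist (x i) (x j) ≤ dist (φ (x i)) (φ (x j)))
      (fun i j h => ⟨h.1.symm, by simpa only [dist_comm] using h.2⟩) (by positivity) hu hu'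
      (fun i => by positivity) (fun i => by linarith)
      (fun i => by simpa [Real.sq_sqrt hθ0.le] using hsparse i)
      (fun i j h => by
        rcases eq_or_ne j i with rfl | hji
        · simp
        · exact (not_le.1 fun h' => h ⟨hji, h'⟩).le)
    refine (med1_le_sum_dist _ v).trans (hv.trans_eq ?_)
    simp [Finset.sum_add_distrib]
  refine le_of_forall_pos_le_add fun δ hδ => ?_
  refine (hε (δ / ((1 + t) * (1 + Real.sqrt θ) * n)) (by positivity)).trans_eq ?_
  field_simp
end
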